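/- Fix an integer N ≥ 2, define h : ℤ[1/N] → ℝ_{≥0} by h(r) = max{k, max(0, log_N |r|)} for nonzero r, where r = a/N^k with k ≥ 0 minimal such that N^k·r ∈ ℤ, and h(0) = 0, and let F be a number field that is Galois over ℚ. Then there exists a constant C ≥ 1 (depending only on N and F) such that for every nonzero r ∈ ℤ[1/N] and every real number n ≥ max(N, h(r)) there is a prime number p with n ≤ p ≤ C·n such that p splits completely in F and the image of r under the natural ring homomorphism ℤ[1/N] → 𝔽_p is nonzero. -/

import Mathlib

/-- `ℤ[1/N]` regarded as a subring of `ℚ`: the subring generated by `ℤ` and `1/N`. -/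
def ZInvN (N : ℕ) : Subring ℚ := Subring.closure {((N : ℚ))⁻¹}

/-- The minimal `k ≥ 0` such that `N^k · r ∈ ℤ` (for `r ∈ ℤ[1/N]` such a `k` exists). -/
noncomputable def denomExp (N : ℕ) (r : ℚ) : ℕ :=
  sInf {k : ℕ | ∃ a : ℤ, (N : ℚ) ^ k * r = (a : ℚ)}

/-- The height `h(r) = max{k, max(0, log_N |r|)}` for nonzero `r = a/N^k` with `k` minimal
such that `N^k·r ∈ ℤ`, and `h(0) = 0`. -/
noncomputable def htZ (N : ℕ) (r : ℚ) : ℝ :=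
  if r = 0 then 0
  else max (denomExp N r : ℝ) (max 0 (Real.logb N |(r : ℝ)|))

/-- A prime number `p` splits completely in a number field `F` if the number of ring
homomorphisms from the ring of integers of `F` (the integral closure of `ℤ` in `F`)
to `𝔽_p` equals the degree `[F : ℚ]`. -/
def SplitsCompletely (F : Type*) [Field F] [Algebra ℚ F] (p : ℕ) : Prop :=
  Nat.card ((integralClosure ℤ F) →+* ZMod p) = Module.finrank ℚ F

open Finset

/-- Chebyshev's upper bound, weighted by a power of the prime. -/
lemma exists_sum_log_mul_rpow_le {δ : ℝ} (hδ : 0 < δ) (hδ1 : δ ≤ 1) :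
    ∃ E : ℝ, 0 ≤ E ∧ ∀ y : ℕ,
      ∑ p ∈ Ioc 0 y with p.Prime, Real.log p * (p : ℝ) ^ (δ - 1) ≤ E * (y : ℝ) ^ δ := by
  set s : ℝ := (2 : ℝ)⁻¹ ^ δ with hs
  have hs0 : 0 < s := by positivity
  have hs1 : s < 1 := Real.rpow_lt_one (by norm_num) (by norm_num) hδ
  have hl4 : 0 < Real.log 4 := Real.log_pos (by norm_num)
  have h1s : 0 < 1 - s := by linarith
  refine ⟨2 * Real.log 4 / (1 - s), by positivity, fun y => ?_⟩
  induction y using Nat.strong_induction_on with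
  | _ y ih =>
  rcases Nat.eq_zero_or_pos y with rfl | hy
  · simp [Real.zero_rpow hδ.ne']
  have hy' : (0 : ℝ) < y := by exact_mod_cast hy
  have hE : 0 ≤ 2 * Real.log 4 / (1 - s) := by positivity
  have hhalf : ((y / 2 : ℕ) : ℝ) ≤ 2⁻¹ * y := by
    have := @Nat.cast_div_le ℝ _ _ _ y 2
    push_cast at this
    linarith
  have hsplit : ∑ p ∈ Ioc 0 y with p.Prime, Real.log p * (p : ℝ) ^ (δ - 1) =
      ∑ p ∈ Ioc 0 (y / 2) with p.Prime, Real.log p * (p : ℝ) ^ (δ - 1) +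
      ∑ p ∈ Ioc (y / 2) y with p.Prime, Real.log p * (p : ℝ) ^ (δ - 1) := by
    simp only [Finset.sum_filter]
    exact (Finset.sum_Ioc_consecutive _ (Nat.zero_le _) (Nat.div_le_self _ _)).symm
  have hlow : ∑ p ∈ Ioc 0 (y / 2) with p.Prime, Real.log p * (p : ℝ) ^ (δ - 1) ≤
      2 * Real.log 4 / (1 - s) * (s * (y : ℝ) ^ δ) := by
    refine (ih (y / 2) (Nat.div_lt_self hy (by norm_num))).trans ?_
    gcongr
    rw [hs, ← Real.mul_rpow (by norm_num) hy'.le]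
    exact Real.rpow_le_rpow (by positivity) hhalf hδ.le
  have hhigh : ∑ p ∈ Ioc (y / 2) y with p.Prime, Real.log p * (p : ℝ) ^ (δ - 1) ≤
      2 * Real.log 4 * (y : ℝ) ^ δ := by
    have hpt : ∀ p ∈ (Ioc (y / 2) y).filter Nat.Prime,
        Real.log p * (p : ℝ) ^ (δ - 1) ≤ Real.log p * (2 * (y : ℝ) ^ (δ - 1)) := by
      intro p hp
      rw [Finset.mem_filter, Finset.mem_Ioc] at hp
      have hp2 : (y : ℝ) * 2⁻¹ ≤ p := by
        have : y ≤ 2 * p := by omega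
        have : (y : ℝ) ≤ 2 * p := by exact_mod_cast this
        linarith
      refine mul_le_mul_of_nonneg_left ?_ (Real.log_natCast_nonneg p)
      calc (p : ℝ) ^ (δ - 1) ≤ ((y : ℝ) * 2⁻¹) ^ (δ - 1) :=
            Real.rpow_le_rpow_of_nonpos (by positivity) hp2 (by linarith)
        _ = (y : ℝ) ^ (δ - 1) * (2 : ℝ) ^ (1 - δ) := by
            rw [Real.mul_rpow hy'.le (by norm_num), Real.inv_rpow (by norm_num),
              ← Real.rpow_neg (by norm_num), neg_sub]
        _ ≤ (y : ℝ) ^ (δ - 1) * 2 := by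
            gcongr
            calc (2 : ℝ) ^ (1 - δ) ≤ 2 ^ (1 : ℝ) :=
                  Real.rpow_le_rpow_of_exponent_le (by norm_num) (by linarith)
              _ = 2 := Real.rpow_one 2
        _ = _ := by ring
    refine (Finset.sum_le_sum hpt).trans ?_
    rw [← Finset.sum_mul]
    have hθ : ∑ p ∈ Ioc (y / 2) y with p.Prime, Real.log p ≤ Real.log 4 * y := by
      refine le_trans ?_ (Chebyshev.theta_le_log4_mul_x hy'.le)
      rw [Chebyshev.theta, Nat.floor_natCast]
      refine Finset.sum_le_sum_of_subset_of_nonneg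
        (Finset.filter_subset_filter _ (Finset.Ioc_subset_Ioc_left (Nat.zero_le _)))
        fun p _ _ => Real.log_natCast_nonneg p
    calc _ ≤ Real.log 4 * y * (2 * (y : ℝ) ^ (δ - 1)) := by gcongr
      _ = 2 * Real.log 4 * ((y : ℝ) ^ (δ - 1) * y) := by ring
      _ = _ := by
        rw [← Real.rpow_add_one hy'.ne']
        ring_nf
  rw [hsplit]
  calc _ ≤ 2 * Real.log 4 / (1 - s) * (s * (y : ℝ) ^ δ) + 2 * Real.log 4 * (y : ℝ) ^ δ :=
        add_le_add hlow hhigh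
    _ = _ := by field_simp; ring

section Lattice

variable {ι O : Type*} [Fintype ι] [CommRing O]

open scoped Classical in
/-- The elements of `O` whose coordinates in the basis `b` lie in a given cube. -/
noncomputable def coordBox (b : Module.Basis ι ℤ O) (c : ι → ℤ) (X : ℕ) : Finset O :=
  (Fintype.piFinset fun i => Finset.Ico (c i) (c i + X)).map b.equivFun.symm.toEquiv.toEmbedding

lemma mem_coordBox {b : Module.Basis ι ℤ O} {c : ι → ℤ} {X : ℕ} {v : O} :
    v ∈ coordBox b c X ↔ ∀ i, c i ≤ b.repr v i ∧ b.repr v i < c i + X := by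
  classical
  unfold coordBox
  rw [Finset.mem_map_equiv, Fintype.mem_piFinset]
  simp

lemma card_coordBox (b : Module.Basis ι ℤ O) (c : ι → ℤ) (X : ℕ) :
    #(coordBox b c X) = X ^ Fintype.card ι := by
  classical
  simp [coordBox, Fintype.card_piFinset]

variable [IsDedekindDomain O] [Module.Free ℤ O]

lemma Ideal.natCard_quotient_eq_absNorm (I : Ideal O) : Nat.card (O ⧸ I) = I.absNorm := by
  rw [Ideal.absNorm_apply]; rfl

variable [Module.Finite ℤ O]

lemma exists_mem_ideal_abs_repr_le (b : Module.Basis ι ℤ O) {I : Ideal O} (hI : I ≠ ⊥) {m : ℕ}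
    (hm : I.absNorm < (m + 1) ^ Fintype.card ι) :
    ∃ α ∈ I, α ≠ 0 ∧ ∀ i, |b.repr α i| ≤ m := by
  classical
  have : Finite (O ⧸ I) := Ideal.finiteQuotientOfFreeOfNeBot I hI
  have : Fintype (O ⧸ I) := Fintype.ofFinite _
  have hcard : #(Finset.univ : Finset (O ⧸ I)) < #(coordBox b 0 (m + 1)) := by
    rw [card_coordBox, Finset.card_univ, ← Nat.card_eq_fintype_card,
      Ideal.natCard_quotient_eq_absNorm]
    exact hm
  obtain ⟨u, hu, v, hv, huv, h⟩ := Finset.exists_ne_map_eq_of_card_lt_of_maps_to hcard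
    (f := Ideal.Quotient.mk I) (fun a _ => Finset.mem_univ _)
  refine ⟨u - v, Ideal.Quotient.eq.mp h, sub_ne_zero.mpr huv, fun i => ?_⟩
  rw [mem_coordBox] at hu hv
  have h1 := hu i
  have h2 := hv i
  simp only [Pi.zero_apply] at h1 h2
  rw [map_sub, Finsupp.sub_apply, abs_le]
  push_cast at h1 h2
  constructor <;> linarith

/-- Every residue class modulo `I` has a representative with coordinates bounded by a constant
times the coordinates of a short element of `I`. -/
lemma exists_forall_exists_sub_mem_abs_repr_le (b : Module.Basis ι ℤ O) :
    ∃ C : ℕ, ∀ (I : Ideal O) (m : ℕ), I ≠ ⊥ → I.absNorm < (m + 1) ^ Fintype.card ι →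
      ∀ v : O, ∃ t : O, v - t ∈ I ∧ ∀ i, |b.repr t i| ≤ C * m := by
  refine ⟨∑ i, ∑ j, ∑ k, (b.repr (b i * b j) k).natAbs, fun I m hI hm v => ?_⟩
  obtain ⟨α, hαI, hα, hαm⟩ := exists_mem_ideal_abs_repr_le b hI hm
  obtain ⟨γ, hγ⟩ := Ideal.mem_span_singleton'.mp (Ideal.absNorm_mem (Ideal.span {α}))
  set n := (Ideal.span {α}).absNorm with hn
  have hn0 : (n : ℤ) ≠ 0 := by
    rw [hn, Nat.cast_ne_zero, Ne, Ideal.absNorm_eq_zero_iff, Ideal.span_singleton_eq_bot]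
    exact hα
  have hnpos : (0 : ℤ) < n := by positivity
  set g := b.repr (γ * v)
  set q : O := ∑ j, (g j / n) • b j with hq
  set ρ : O := ∑ j, (g j % n) • b j with hρ
  have hdecomp : γ * v = n * q + ρ := by
    rw [hq, hρ, Finset.mul_sum, ← Finset.sum_add_distrib]
    conv_lhs => rw [← b.sum_repr (γ * v)]
    refine Finset.sum_congr rfl fun j _ => ?_
    have : g j = n * (g j / n) + g j % n := (Int.mul_ediv_add_emod _ _).symm
    calc g j • b j = (n * (g j / n) + g j % n) • b j := by rw [← this]
      _ = _ := by simp [add_smul, mul_smul, zsmul_eq_mul]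
  refine ⟨v - α * q, by simpa using I.mul_mem_right q hαI, fun i => ?_⟩
  have hnt : (n : ℤ) • (v - α * q) = α * ρ := by
    have h1 : (n : O) = γ * α := hγ.symm
    have : ρ = γ * v - n * q := by rw [hdecomp]; ring
    rw [this, zsmul_eq_mul, Int.cast_natCast, h1]; ring
  have hcoord : (n : ℤ) * b.repr (v - α * q) i =
      ∑ k, ∑ j, b.repr α k * (g j % n) * b.repr (b k * b j) i := by
    have : α * ρ = ∑ k, ∑ j, (b.repr α k * (g j % n)) • (b k * b j) := by
      conv_lhs => rw [← b.sum_repr α, hρ, Finset.sum_mul_sum]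
      refine Finset.sum_congr rfl fun k _ => Finset.sum_congr rfl fun j _ => ?_
      rw [smul_mul_smul_comm]
    rw [← smul_eq_mul, ← Finsupp.smul_apply, ← map_smul, hnt, this]
    simp only [map_sum, map_smul, Finsupp.finsetSum_apply, Finsupp.smul_apply, smul_eq_mul]
  have hbound : (n : ℤ) * |b.repr (v - α * q) i| ≤
      n * (((∑ i, ∑ j, ∑ k, (b.repr (b i * b j) k).natAbs : ℕ) : ℤ) * m) := by
    rw [← abs_of_pos hnpos, ← abs_mul, abs_of_pos hnpos, hcoord]
    calc _ ≤ ∑ k, ∑ j, |b.repr α k * (g j % n) * b.repr (b k * b j) i| :=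
          (Finset.abs_sum_le_sum_abs _ _).trans
            (Finset.sum_le_sum fun k _ => Finset.abs_sum_le_sum_abs _ _)
      _ ≤ ∑ k, ∑ j, (m * n) * ∑ l, |b.repr (b k * b j) l| := by
          refine Finset.sum_le_sum fun k _ => Finset.sum_le_sum fun j _ => ?_
          rw [abs_mul, abs_mul]
          have h1 : |g j % n| ≤ n := by
            rw [abs_of_nonneg (Int.emod_nonneg _ hn0)]
            exact (Int.emod_lt_of_pos _ hnpos).le
          have h2 : |b.repr (b k * b j) i| ≤ ∑ l, |b.repr (b k * b j) l| :=
            Finset.single_le_sum (f := fun l => |b.repr (b k * b j) l|)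
              (fun l _ => abs_nonneg _) (Finset.mem_univ i)
          gcongr
          exact hαm k
      _ = _ := by
          push_cast
          simp only [← Finset.mul_sum]
          ring
  exact le_of_mul_le_mul_left hbound hnpos

open scoped Classical in
lemma absNorm_mul_card_coordBox_filter_le (b : Module.Basis ι ℤ O) {I : Ideal O} (hI : I ≠ ⊥)
    {R : ℕ} (hR : ∀ v : O, ∃ t : O, v - t ∈ I ∧ ∀ i, |b.repr t i| ≤ R) (c : ι → ℤ) (X : ℕ) :
    I.absNorm * #{v ∈ coordBox b c X | v ∈ I} ≤ (X + 2 * R) ^ Fintype.card ι := by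
  have : Finite (O ⧸ I) := Ideal.finiteQuotientOfFreeOfNeBot I hI
  have : Fintype (O ⧸ I) := Fintype.ofFinite _
  choose τ hτ hτR using hR
  have hmk : ∀ q : O ⧸ I, Ideal.Quotient.mk I (τ q.out) = q := fun q => by
    rw [← Ideal.Quotient.eq.mpr (hτ q.out)]; exact Ideal.Quotient.mk_out q
  rw [← Ideal.natCard_quotient_eq_absNorm, Nat.card_eq_fintype_card, ← Finset.card_univ,
    ← Finset.card_product, ← card_coordBox b (fun i => c i - R)]
  refine Finset.card_le_card_of_injOn (fun x => x.2 + τ x.1.out) ?_ ?_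
  · rintro ⟨q, v⟩ hx
    simp only [coe_product, Set.mem_prod, mem_coe, mem_univ, true_and, mem_filter] at hx
    rw [mem_coe, mem_coordBox]
    intro i
    have h1 := mem_coordBox.mp hx.1 i
    have h2 := abs_le.mp (hτR q.out i)
    simp only [map_add, Finsupp.add_apply]
    push_cast
    constructor <;> linarith
  · rintro ⟨q, v⟩ hx ⟨q', v'⟩ hx' h
    simp only [coe_product, Set.mem_prod, mem_coe, mem_univ, true_and, mem_filter] at hx hx' h
    have hq : q = q' := by
      have := congrArg (Ideal.Quotient.mk I) h
      simpa [hmk, Ideal.Quotient.eq_zero_iff_mem.mpr hx.2,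
        Ideal.Quotient.eq_zero_iff_mem.mpr hx'.2] using this
    subst hq
    simpa using h

open scoped Classical in
lemma le_absNorm_mul_card_coordBox_filter (b : Module.Basis ι ℤ O) {I : Ideal O} (hI : I ≠ ⊥)
    {R : ℕ} (hR : ∀ v : O, ∃ t : O, v - t ∈ I ∧ ∀ i, |b.repr t i| ≤ R) (c : ι → ℤ) {X : ℕ}
    (hX : 2 * R ≤ X) :
    (X - 2 * R) ^ Fintype.card ι ≤ I.absNorm * #{v ∈ coordBox b c X | v ∈ I} := by
  have : Finite (O ⧸ I) := Ideal.finiteQuotientOfFreeOfNeBot I hI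
  have : Fintype (O ⧸ I) := Fintype.ofFinite _
  choose τ hτ hτR using hR
  have hmk : ∀ q : O ⧸ I, Ideal.Quotient.mk I (τ q.out) = q := fun q => by
    rw [← Ideal.Quotient.eq.mpr (hτ q.out)]; exact Ideal.Quotient.mk_out q
  rw [← card_coordBox b (fun i => c i + R), ← Ideal.natCard_quotient_eq_absNorm,
    Nat.card_eq_fintype_card, ← Finset.card_univ, ← Finset.card_product]
  refine Finset.card_le_card_of_injOn
    (fun v => (Ideal.Quotient.mk I v, v - τ (Ideal.Quotient.mk I v).out)) ?_ ?_
  · intro v hv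
    rw [mem_coe, mem_coordBox] at hv
    simp only [coe_product, Set.mem_prod, mem_coe, mem_univ, true_and, mem_filter]
    refine ⟨mem_coordBox.mpr fun i => ?_, ?_⟩
    · have h1 := hv i
      have h2 := abs_le.mp (hτR (Ideal.Quotient.mk I v).out i)
      rw [Nat.cast_sub hX] at h1
      push_cast at h1
      simp only [map_sub, Finsupp.sub_apply]
      constructor <;> linarith
    · rw [← Ideal.Quotient.eq_zero_iff_mem, map_sub, hmk, sub_self]
  · intro v _ w _ h
    simp only [Prod.mk.injEq] at h
    obtain ⟨h1, h2⟩ := h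
    rw [h1] at h2
    simpa using h2

end Lattice

section Factor

variable {O : Type*} [CommRing O] [IsDedekindDomain O] [Module.Free ℤ O] [Module.Finite ℤ O]

open scoped Classical in
lemma sum_log_absNorm_le {J : Ideal O} (hJ : J ≠ ⊥) {s : Finset (Ideal O)}
    (hs : ∀ P ∈ s, Prime P) :
    ∑ P ∈ s with P ∣ J, Real.log P.absNorm ≤ Real.log J.absNorm := by
  have hdvd : ∏ P ∈ s with P ∣ J, P ∣ J := by
    refine Finset.prod_primes_dvd J (fun P hP => hs P (mem_filter.mp hP).1)
      fun P hP => (mem_filter.mp hP).2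
  have hpos : ∀ P ∈ s, P.absNorm ≠ 0 := fun P hP =>
    Ideal.absNorm_eq_zero_iff.not.mpr (hs P hP).ne_zero
  have hJ0 : J.absNorm ≠ 0 := Ideal.absNorm_eq_zero_iff.not.mpr hJ
  rw [← Real.log_prod (fun P hP => by exact_mod_cast hpos P (mem_filter.mp hP).1)]
  have h1 := Nat.le_of_dvd (Nat.pos_of_ne_zero hJ0) (map_dvd Ideal.absNorm hdvd)
  rw [map_prod] at h1
  refine Real.log_le_log (Finset.prod_pos fun P hP => ?_) (by exact_mod_cast h1)
  exact_mod_cast Nat.pos_of_ne_zero (hpos P (mem_filter.mp hP).1)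

open scoped Classical in
lemma log_absNorm_le_sum {J : Ideal O} (hJ : J ≠ ⊥) {s : Finset (Ideal O)} {K : ℕ}
    (hs : ∀ P, Prime P → P ∣ J → P ∈ s) (hK : J.absNorm < 2 ^ K) :
    Real.log J.absNorm ≤
      ∑ P ∈ s, ∑ k ∈ Icc 1 K, if P ^ k ∣ J then Real.log P.absNorm else 0 := by
  set f := UniqueFactorizationMonoid.normalizedFactors J with hf
  have hprime : ∀ P ∈ f, Prime P := fun P hP =>
    UniqueFactorizationMonoid.prime_of_normalized_factor P hP
  have hprod : f.prod = J := by
    simpa using UniqueFactorizationMonoid.prod_normalizedFactors_eq hJ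
  have hJ0 : J.absNorm ≠ 0 := Ideal.absNorm_eq_zero_iff.not.mpr hJ
  have hlog : Real.log J.absNorm = ∑ P ∈ f.toFinset, f.count P • Real.log P.absNorm := by
    conv_lhs => rw [← hprod, Finset.prod_multiset_count, map_prod]
    push_cast
    rw [Real.log_prod]
    · refine Finset.sum_congr rfl fun P _ => ?_
      rw [map_pow, Nat.cast_pow, Real.log_pow, nsmul_eq_mul]
    · intro P hP
      rw [map_pow]
      have := Ideal.absNorm_eq_zero_iff.not.mpr (hprime P (Multiset.mem_toFinset.mp hP)).ne_zero
      exact_mod_cast pow_ne_zero _ this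
  rw [hlog]
  have hnn : ∀ P ∈ s, 0 ≤ ∑ k ∈ Icc 1 K, if P ^ k ∣ J then Real.log P.absNorm else 0 :=
    fun P _ => Finset.sum_nonneg fun k _ => by
      split_ifs
      exacts [Real.log_natCast_nonneg _, le_rfl]
  have hsub : f.toFinset ⊆ s := fun P hP => by
    have hP := Multiset.mem_toFinset.mp hP
    exact hs P (hprime P hP) (UniqueFactorizationMonoid.dvd_of_mem_normalizedFactors hP)
  refine le_trans (Finset.sum_le_sum fun P hP => ?_)
    (Finset.sum_le_sum_of_subset_of_nonneg hsub fun P hP _ => hnn P hP)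
  have hP := Multiset.mem_toFinset.mp hP
  have hpow : P ^ f.count P ∣ J := by
    rw [← Multiset.prod_replicate]
    conv_rhs => rw [← hprod]
    exact Multiset.prod_dvd_prod_of_le (Multiset.le_count_iff_replicate_le.mp le_rfl)
  have hNP : 2 ≤ P.absNorm := by
    have h0 := Ideal.absNorm_eq_zero_iff.not.mpr (hprime P hP).ne_zero
    have h1 : P.absNorm ≠ 1 := fun h => (hprime P hP).not_isUnit
      (Ideal.isUnit_iff.mpr (Ideal.absNorm_eq_one_iff.mp h))
    omega
  have hcount : f.count P ≤ K := by
    have h1 := Nat.le_of_dvd (Nat.pos_of_ne_zero hJ0) (map_dvd Ideal.absNorm hpow)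
    rw [map_pow] at h1
    have h2 := ((Nat.pow_le_pow_left hNP _).trans h1).trans_lt hK
    exact ((Nat.pow_lt_pow_iff_right (by norm_num)).mp h2).le
  calc f.count P • Real.log P.absNorm
      = ∑ k ∈ Icc 1 (f.count P), Real.log P.absNorm := by simp
    _ = ∑ k ∈ Icc 1 (f.count P), if P ^ k ∣ J then Real.log P.absNorm else 0 := by
        refine Finset.sum_congr rfl fun k hk => ?_
        rw [if_pos ((pow_dvd_pow P (Finset.mem_Icc.mp hk).2).trans hpow)]
    _ ≤ _ := by
        refine Finset.sum_le_sum_of_subset_of_nonneg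
          (Finset.Icc_subset_Icc_right hcount) fun k _ _ => ?_
        split_ifs
        exacts [Real.log_natCast_nonneg _, le_rfl]

end Factor

section Norm

variable (F : Type*) [Field F] [NumberField F]
open NumberField

/-- A cube of side `X` can be translated so that all its elements have norm comparable to
`X ^ [F : ℚ]`. -/
lemma exists_pow_le_absNorm_le :
    ∃ M : ℕ, 1 ≤ M ∧ ∀ X : ℕ, ∃ c : Module.Free.ChooseBasisIndex ℤ (𝓞 F) → ℤ, ∀ v : 𝓞 F,
      (∀ i, c i ≤ (RingOfIntegers.basis F).repr v i ∧
        (RingOfIntegers.basis F).repr v i < c i + X) →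
      X ^ Module.finrank ℚ F ≤ (Ideal.span {v}).absNorm ∧
      (Ideal.span {v}).absNorm ≤ M * X ^ Module.finrank ℚ F := by
  set b := RingOfIntegers.basis F
  obtain ⟨B, hB⟩ : ∃ B : ℕ, ∀ σ : F →ₐ[ℚ] ℂ, ∑ i, ‖σ (b i)‖ ≤ B := by
    obtain ⟨B, hB⟩ := (Set.finite_range fun σ : F →ₐ[ℚ] ℂ => ∑ i, ‖σ (b i)‖).bddAbove
    obtain ⟨n, hn⟩ := exists_nat_ge B
    exact ⟨n, fun σ => (hB ⟨σ, rfl⟩).trans hn⟩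
  refine ⟨(2 * B + 1) ^ Module.finrank ℚ F, Nat.one_le_pow _ _ (by omega), fun X =>
    ⟨fun i => b.repr (((B + 1) * X : ℕ) : 𝓞 F) i, fun v hv => ?_⟩⟩
  set β : 𝓞 F := v - ((B + 1) * X : ℕ) with hβ
  have hβσ : ∀ σ : F →ₐ[ℚ] ℂ, ‖σ β‖ ≤ B * X := fun σ => by
    have h1 : (σ β : ℂ) = ∑ i, (b.repr β i : ℂ) * σ (b i) := by
      conv_lhs => rw [← b.sum_repr β]
      simp
    rw [h1]
    calc _ ≤ ∑ i, ‖(b.repr β i : ℂ) * σ (b i)‖ := norm_sum_le _ _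
      _ ≤ ∑ i, (X : ℝ) * ‖σ (b i)‖ := by
        refine Finset.sum_le_sum fun i _ => ?_
        rw [norm_mul]
        gcongr
        have h2 := hv i
        have h3 : b.repr β i = b.repr v i - b.repr (((B + 1) * X : ℕ) : 𝓞 F) i := by
          rw [hβ, map_sub, Finsupp.sub_apply]
        have h4 : |b.repr β i| ≤ X := abs_le.mpr ⟨by linarith, by linarith⟩
        rw [Complex.norm_intCast]
        exact_mod_cast h4
      _ = X * ∑ i, ‖σ (b i)‖ := by rw [Finset.mul_sum]
      _ ≤ X * B := by gcongr; exact hB σ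
      _ = _ := mul_comm _ _
  have hvσ : ∀ σ : F →ₐ[ℚ] ℂ, (X : ℝ) ≤ ‖σ v‖ ∧ ‖σ v‖ ≤ (2 * B + 1) * X := fun σ => by
    have h1 : (σ v : ℂ) = ((B + 1) * X : ℕ) + σ β := by
      rw [hβ]; push_cast; simp
    have h2 : ‖(((B + 1) * X : ℕ) : ℂ)‖ = (B + 1) * X := by
      rw [Complex.norm_natCast]; push_cast; ring
    rw [h1]
    constructor
    · have := norm_sub_le_norm_add (((B + 1) * X : ℕ) : ℂ) (σ β)
      linarith [hβσ σ]
    · have := norm_add_le (((B + 1) * X : ℕ) : ℂ) (σ β)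
      linarith [hβσ σ]
  have hcard : Fintype.card (F →ₐ[ℚ] ℂ) = Module.finrank ℚ F := AlgHom.card ℚ F ℂ
  have hnorm : (((Ideal.span {v}).absNorm : ℕ) : ℝ) = ∏ σ : F →ₐ[ℚ] ℂ, ‖σ v‖ := by
    have h1 := Algebra.norm_eq_prod_embeddings ℚ ℂ (v : F)
    rw [← Algebra.coe_norm_int] at h1
    rw [Ideal.absNorm_span_singleton, ← norm_prod, ← h1]
    simp [Nat.cast_natAbs]
  constructor
  · have : (X : ℝ) ^ Module.finrank ℚ F ≤ (Ideal.span {v}).absNorm := by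
      rw [hnorm, ← hcard, ← Finset.card_univ, ← Finset.prod_const]
      exact Finset.prod_le_prod (fun σ _ => by positivity) fun σ _ => (hvσ σ).1
    exact_mod_cast this
  · have : ((Ideal.span {v}).absNorm : ℝ) ≤ ((2 * B + 1) * X) ^ Module.finrank ℚ F := by
      rw [hnorm, ← hcard, ← Finset.card_univ, ← Finset.prod_const]
      exact Finset.prod_le_prod (fun σ _ => norm_nonneg _) fun σ _ => (hvσ σ).2
    rw [mul_pow] at this
    exact_mod_cast this

end Norm

section Estimates

lemma one_add_pow_le {w W : ℝ} (hw : 0 ≤ w) (hW : w ≤ W) (d : ℕ) :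
    (1 + w) ^ d ≤ 1 + d * w * (1 + W) ^ d := by
  induction d with
  | zero => simp
  | succ d ih =>
    have hW0 : 0 ≤ 1 + W := by linarith
    have h1 : 1 ≤ (1 + W) ^ (d + 1) := one_le_pow₀ (by linarith)
    calc (1 + w) ^ (d + 1) = (1 + w) ^ d * (1 + w) := pow_succ _ _
      _ ≤ (1 + d * w * (1 + W) ^ d) * (1 + w) := by gcongr
      _ = 1 + w * 1 + d * w * ((1 + W) ^ d * (1 + w)) := by ring
      _ ≤ 1 + w * (1 + W) ^ (d + 1) + d * w * ((1 + W) ^ d * (1 + W)) := by gcongr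
      _ = _ := by push_cast; ring

variable {ι O : Type*} [Fintype ι] [Nonempty ι] [CommRing O] [IsDedekindDomain O]
  [Module.Free ℤ O] [Module.Finite ℤ O]

open scoped Classical in
/-- The number of elements of an ideal in a cube, with a power saving error term that is uniform
in the ideal. -/
lemma exists_card_coordBox_filter_estimate (b : Module.Basis ι ℤ O) (M : ℕ) :
    ∃ D : ℝ, 0 ≤ D ∧ ∀ (I : Ideal O) (c : ι → ℤ) (X : ℕ), I ≠ ⊥ → 0 < X →
      (X : ℝ) ^ Fintype.card ι *
          (1 - D * ((I.absNorm : ℝ) ^ ((Fintype.card ι : ℝ)⁻¹) / X)) ≤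
        I.absNorm * #{v ∈ coordBox b c X | v ∈ I} ∧
      (I.absNorm ≤ M * X ^ Fintype.card ι →
        (I.absNorm : ℝ) * #{v ∈ coordBox b c X | v ∈ I} ≤ (X : ℝ) ^ Fintype.card ι *
          (1 + D * ((I.absNorm : ℝ) ^ ((Fintype.card ι : ℝ)⁻¹) / X))) := by
  obtain ⟨C, hC⟩ := exists_forall_exists_sub_mem_abs_repr_le b
  set d := Fintype.card ι with hd
  have hd0 : d ≠ 0 := Fintype.card_ne_zero
  have hd1 : (1 : ℝ) ≤ d := by exact_mod_cast Nat.one_le_iff_ne_zero.mpr hd0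
  set δ : ℝ := (d : ℝ)⁻¹ with hδ
  have hδ0 : 0 < δ := by positivity
  set W : ℝ := 1 + 2 * C * (M : ℝ) ^ δ with hW
  have hW1 : 1 ≤ W := by
    have : 0 ≤ 2 * C * (M : ℝ) ^ δ := by positivity
    linarith
  have hWd : 1 ≤ W ^ d := one_le_pow₀ hW1
  refine ⟨d * (2 * C) * W ^ d, by positivity, fun I c X hI hX => ?_⟩
  set A : ℝ := (I.absNorm : ℝ) with hA
  have hA0 : 0 < A := by
    have := Ideal.absNorm_eq_zero_iff.not.mpr hI
    positivity
  have hX' : (0 : ℝ) < X := by exact_mod_cast hX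
  set m := ⌊A ^ δ⌋₊ with hm
  have hmle : (m : ℝ) ≤ A ^ δ := Nat.floor_le (by positivity)
  have hAm : I.absNorm < (m + 1) ^ d := by
    have h1 : A < ((m : ℝ) + 1) ^ d := by
      calc A = (A ^ δ) ^ d := (Real.rpow_inv_natCast_pow hA0.le hd0).symm
        _ < _ := by
          gcongr
          exact Nat.lt_floor_add_one _
    rw [hA] at h1
    exact_mod_cast h1
  have hR : ∀ v : O, ∃ t : O, v - t ∈ I ∧ ∀ i, |b.repr t i| ≤ (C * m : ℕ) := by
    simpa using hC I m hI hAm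
  set u : ℝ := A ^ δ / X with hu
  have hu0 : 0 ≤ u := by positivity
  have hRu : 2 * ((C * m : ℕ) : ℝ) ≤ X * (2 * C * u) := by
    calc 2 * ((C * m : ℕ) : ℝ) = 2 * C * m := by push_cast; ring
      _ ≤ 2 * C * A ^ δ := by gcongr
      _ = _ := by rw [hu]; field_simp
  constructor
  · have hD : 2 * C * u * d ≤ d * (2 * C) * W ^ d * u := by
      calc 2 * C * u * d = d * (2 * C) * 1 * u := by ring
        _ ≤ _ := by gcongr
    by_cases h : 2 * (C * m) ≤ X
    · have h1 := le_absNorm_mul_card_coordBox_filter b hI hR c h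
      have h2 : ((X : ℝ) - 2 * (C * m : ℕ)) ^ d ≤ A * #{v ∈ coordBox b c X | v ∈ I} := by
        have h3 : ((X - 2 * (C * m) : ℕ) : ℝ) = (X : ℝ) - 2 * (C * m : ℕ) := by
          rw [Nat.cast_sub h]; push_cast; ring
        rw [← h3, hA]
        exact_mod_cast h1
      refine le_trans ?_ h2
      have h3 : (2 * ((C * m : ℕ) : ℝ)) / X ≤ 2 * C * u := by
        rw [div_le_iff₀ hX']; linarith
      have h4 : (2 * ((C * m : ℕ) : ℝ)) / X ≤ 1 := by
        rw [div_le_one hX']; exact_mod_cast h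
      have h5 : ((X : ℝ) - 2 * (C * m : ℕ)) = X * (1 + -((2 * ((C * m : ℕ) : ℝ)) / X)) := by
        field_simp
        ring
      rw [h5, mul_pow]
      refine mul_le_mul_of_nonneg_left ?_ (by positivity)
      refine le_trans ?_ (one_add_mul_le_pow (by linarith) d)
      nlinarith
    · have h1 : (X : ℝ) < 2 * ((C * m : ℕ) : ℝ) := by exact_mod_cast not_le.mp h
      have h2 : 1 ≤ 2 * C * u := by
        by_contra! h3
        nlinarith
      refine le_trans ?_ (by positivity : (0 : ℝ) ≤ A * #{v ∈ coordBox b c X | v ∈ I})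
      refine mul_nonpos_of_nonneg_of_nonpos (by positivity) ?_
      nlinarith
  · intro hAM
    have h1 := absNorm_mul_card_coordBox_filter_le b hI hR c X
    have h2 : A * #{v ∈ coordBox b c X | v ∈ I} ≤ ((X : ℝ) + 2 * (C * m : ℕ)) ^ d := by
      rw [hA]
      exact_mod_cast h1
    have huM : u ≤ (M : ℝ) ^ δ := by
      rw [hu, div_le_iff₀ hX']
      calc A ^ δ ≤ ((M : ℝ) * (X : ℝ) ^ d) ^ δ := by
            refine Real.rpow_le_rpow hA0.le ?_ hδ0.le
            rw [hA]
            exact_mod_cast hAM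
        _ = _ := by
          rw [Real.mul_rpow (by positivity) (by positivity), hδ,
            Real.pow_rpow_inv_natCast hX'.le hd0]
    calc A * #{v ∈ coordBox b c X | v ∈ I} ≤ ((X : ℝ) + 2 * (C * m : ℕ)) ^ d := h2
      _ ≤ ((X : ℝ) + X * (2 * C * u)) ^ d := by gcongr
      _ = (X : ℝ) ^ d * (1 + 2 * C * u) ^ d := by rw [← mul_pow]; ring
      _ ≤ (X : ℝ) ^ d * (1 + d * (2 * C * u) * W ^ d) := by
          gcongr
          rw [hW]
          exact one_add_pow_le (by positivity) (by gcongr) d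
      _ = _ := by ring

end Estimates

section PrimeSums

variable {O : Type*} [CommRing O] [IsDedekindDomain O] [Module.Free ℤ O] [Module.Finite ℤ O]

lemma Prime.two_le_absNorm {P : Ideal O} (hP : Prime P) : 2 ≤ P.absNorm := by
  have h0 := Ideal.absNorm_eq_zero_iff.not.mpr hP.ne_zero
  have h1 : P.absNorm ≠ 1 := fun h => hP.not_isUnit
    (Ideal.isUnit_iff.mpr (Ideal.absNorm_eq_one_iff.mp h))
  omega

lemma absNorm_span_natCast_singleton (n : ℕ) :
    (Ideal.span {(n : O)}).absNorm = n ^ Module.finrank ℤ O := by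
  have h : (n : O) = algebraMap ℤ O n := by simp
  rw [Ideal.absNorm_span_singleton, h, Algebra.norm_algebraMap, Int.natAbs_pow, Int.natAbs_natCast]

lemma exists_prime_mem_minFac_absNorm_eq {P : Ideal O} (hP : Prime P) :
    P.absNorm.minFac.Prime ∧ (P.absNorm.minFac : O) ∈ P ∧
      ∃ k, P.absNorm = P.absNorm.minFac ^ k := by
  have : P.IsPrime := Ideal.isPrime_of_prime hP
  have : NeZero P := ⟨hP.ne_zero⟩
  obtain ⟨q, hq, hqP⟩ : ∃ q : ℕ, q.Prime ∧ (q : O) ∈ P :=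
    ⟨_, Nat.absNorm_under_prime P, Int.absNorm_under_mem P⟩
  have hdvd : P.absNorm ∣ q ^ Module.finrank ℤ O := by
    rw [← absNorm_span_natCast_singleton]
    exact Ideal.absNorm_dvd_absNorm_of_le ((Ideal.span_singleton_le_iff_mem _).mpr hqP)
  obtain ⟨k, -, hk⟩ := (Nat.dvd_prime_pow hq).mp hdvd
  have hk0 : k ≠ 0 := by
    rintro rfl
    have := hP.two_le_absNorm
    simp [hk] at this
  have hmin : P.absNorm.minFac = q := by rw [hk, hq.pow_minFac hk0]
  rw [hmin]
  exact ⟨hq, hqP, k, hk⟩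

lemma card_le_finrank_of_natCast_mem {s : Finset (Ideal O)} {p : ℕ} (hp : 1 < p)
    (hs : ∀ P ∈ s, Prime P ∧ P.absNorm.minFac = p) : #s ≤ Module.finrank ℤ O := by
  have hdvd : ∏ P ∈ s, P ∣ Ideal.span {(p : O)} :=
    Finset.prod_primes_dvd _ (fun P hP => (hs P hP).1) fun P hP => by
      rw [Ideal.dvd_span_singleton, ← (hs P hP).2]
      exact (exists_prime_mem_minFac_absNorm_eq (hs P hP).1).2.1
  have h1 := map_dvd Ideal.absNorm hdvd
  rw [absNorm_span_natCast_singleton, map_prod] at h1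
  have h2 : p ^ #s ≤ ∏ P ∈ s, P.absNorm := by
    rw [← Finset.prod_const]
    refine Finset.prod_le_prod' fun P hP => ?_
    conv_lhs => rw [← (hs P hP).2]
    exact Nat.minFac_le (by have := (hs P hP).1.two_le_absNorm; omega)
  exact (Nat.pow_le_pow_iff_right hp).mp (h2.trans (Nat.le_of_dvd (by positivity) h1))

lemma sum_minFac_absNorm_le {s : Finset (Ideal O)} {t : Finset ℕ} {f : ℕ → ℝ}
    (hs : ∀ P ∈ s, Prime P ∧ P.absNorm.minFac ∈ t) (hf : ∀ p ∈ t, 0 ≤ f p) :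
    ∑ P ∈ s, f P.absNorm.minFac ≤ Module.finrank ℤ O * ∑ p ∈ t, f p := by
  rw [← Finset.sum_fiberwise_of_maps_to (fun P hP => (hs P hP).2), Finset.mul_sum]
  refine Finset.sum_le_sum fun p hp => ?_
  calc ∑ P ∈ s with P.absNorm.minFac = p, f P.absNorm.minFac
      = ∑ P ∈ s with P.absNorm.minFac = p, f p :=
        Finset.sum_congr rfl fun P hP => by rw [(Finset.mem_filter.mp hP).2]
    _ = #{P ∈ s | P.absNorm.minFac = p} * f p := by rw [Finset.sum_const, nsmul_eq_mul]
    _ ≤ _ := by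
      refine mul_le_mul_of_nonneg_right ?_ (hf p hp)
      rcases Finset.eq_empty_or_nonempty {P ∈ s | P.absNorm.minFac = p} with h | ⟨Q, hQ⟩
      · simp [h]
      · rw [Finset.mem_filter] at hQ
        have hp1 : 1 < p := hQ.2 ▸ (exists_prime_mem_minFac_absNorm_eq (hs Q hQ.1).1).1.one_lt
        exact_mod_cast card_le_finrank_of_natCast_mem hp1 fun P hP =>
          ⟨(hs P (Finset.mem_filter.mp hP).1).1, (Finset.mem_filter.mp hP).2⟩

lemma sum_Icc_inv_pow_le {q : ℝ} (hq : 2 ≤ q) (j K : ℕ) :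
    ∑ k ∈ Icc j K, (q ^ k)⁻¹ ≤ 2 * (q ^ j)⁻¹ := by
  have hq0 : 0 < q := by linarith
  have h1 : q⁻¹ ≤ 1 / 2 := by rw [inv_le_comm₀ hq0 (by norm_num)]; simpa using hq
  have h2 := geom_sum_Ico_le_of_lt_one (m := j) (n := K + 1) (inv_nonneg.mpr hq0.le)
    (by linarith : q⁻¹ < 1)
  have h3 : Finset.Icc j K = Finset.Ico j (K + 1) := by ext; simp
  simp only [inv_pow] at h2
  rw [h3]
  refine h2.trans ?_
  rw [div_le_iff₀ (by linarith)]
  have : 0 ≤ (q ^ j)⁻¹ := by positivity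
  nlinarith

lemma log_le_four_mul_rpow {q : ℝ} (hq : 0 ≤ q) : Real.log q ≤ 4 * q ^ (1 / 4 : ℝ) := by
  have := Real.log_le_rpow_div hq (by norm_num : (0 : ℝ) < 1 / 4)
  linarith

open scoped Classical in
lemma sum_higher_le_rpow_add (D K : ℕ) {P : Ideal O} (hP : Prime P) :
    (∑ k ∈ Icc 1 K, if (P.absNorm.Prime ∧ ¬ P.absNorm ∣ D) ∧ k = 1 then 0 else
        Real.log P.absNorm * ((P.absNorm : ℝ) ^ k)⁻¹) ≤
      8 * (P.absNorm.minFac : ℝ) ^ (-3 / 2 : ℝ) +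
        if P.absNorm.Prime ∧ P.absNorm ∣ D then 2 else 0 := by
  set q := P.absNorm
  have hq : (2 : ℝ) ≤ q := by exact_mod_cast hP.two_le_absNorm
  have hq0 : (0 : ℝ) < q := by linarith
  have hlog : 0 ≤ Real.log q := Real.log_natCast_nonneg q
  have hm0 : 0 ≤ 8 * (q.minFac : ℝ) ^ (-3 / 2 : ℝ) := by positivity
  have hall : (∑ k ∈ Icc 1 K, if (q.Prime ∧ ¬ q ∣ D) ∧ k = 1 then 0 else
      Real.log q * ((q : ℝ) ^ k)⁻¹) ≤ Real.log q * (2 * (q : ℝ)⁻¹) := by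
    calc _ ≤ ∑ k ∈ Icc 1 K, Real.log q * ((q : ℝ) ^ k)⁻¹ := by
          refine Finset.sum_le_sum fun k _ => ?_
          split_ifs
          · positivity
          · exact le_rfl
      _ ≤ _ := by
        rw [← Finset.mul_sum]
        gcongr
        simpa using sum_Icc_inv_pow_le hq 1 K
  by_cases hqp : q.Prime
  · by_cases hqD : q ∣ D
    · rw [if_pos ⟨hqp, hqD⟩]
      have h1 : Real.log q * (2 * (q : ℝ)⁻¹) ≤ 2 := by
        have h2 : Real.log q ≤ q := by linarith [Real.log_le_sub_one_of_pos hq0]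
        calc _ ≤ (q : ℝ) * (2 * (q : ℝ)⁻¹) := by gcongr
          _ = 2 := by field_simp
      linarith
    · rw [if_neg (fun h => hqD h.2), hqp.minFac_eq, add_zero]
      calc _ ≤ ∑ k ∈ Icc 2 K, Real.log q * ((q : ℝ) ^ k)⁻¹ := by
            rw [← Finset.sum_filter_add_sum_filter_not _ (fun k => k = 1)]
            have h1 : ∑ k ∈ Icc 1 K with k = 1, (if (q.Prime ∧ ¬ q ∣ D) ∧ k = 1 then 0 else
                Real.log q * ((q : ℝ) ^ k)⁻¹) = 0 :=
              Finset.sum_eq_zero fun k hk =>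
                if_pos ⟨⟨hqp, hqD⟩, (Finset.mem_filter.mp hk).2⟩
            rw [h1, zero_add]
            have h2 : ∀ k ∈ {k ∈ Icc 1 K | ¬ k = 1}, (if (q.Prime ∧ ¬ q ∣ D) ∧ k = 1 then 0 else
                Real.log q * ((q : ℝ) ^ k)⁻¹) = Real.log q * ((q : ℝ) ^ k)⁻¹ := fun k hk =>
              if_neg fun h => (Finset.mem_filter.mp hk).2 h.2
            rw [Finset.sum_congr rfl h2]
            refine Finset.sum_le_sum_of_subset_of_nonneg (fun k hk => ?_)
              fun k _ _ => by positivity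
            simp only [Finset.mem_filter, Finset.mem_Icc] at hk ⊢
            omega
        _ ≤ Real.log q * (2 * ((q : ℝ) ^ 2)⁻¹) := by
            rw [← Finset.mul_sum]
            gcongr
            exact sum_Icc_inv_pow_le hq 2 K
        _ ≤ 4 * (q : ℝ) ^ (1 / 4 : ℝ) * (2 * ((q : ℝ) ^ 2)⁻¹) := by
            gcongr
            exact log_le_four_mul_rpow hq0.le
        _ = 8 * (q : ℝ) ^ (-7 / 4 : ℝ) := by
            rw [← Real.rpow_natCast, ← Real.rpow_neg hq0.le]
            have : (q : ℝ) ^ (-7 / 4 : ℝ) = (q : ℝ) ^ (1 / 4 : ℝ) * (q : ℝ) ^ (-2 : ℝ) := by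
              rw [← Real.rpow_add hq0]; norm_num
            rw [this]
            push_cast
            ring
        _ ≤ _ := by
            gcongr 8 * ?_
            exact Real.rpow_le_rpow_of_exponent_le (by linarith) (by norm_num)
  · rw [if_neg (fun h => hqp h.1), add_zero]
    refine hall.trans ?_
    have hmp := (exists_prime_mem_minFac_absNorm_eq hP).1
    have hsq : ((q.minFac : ℝ)) ^ 2 ≤ q := by
      exact_mod_cast Nat.minFac_sq_le_self (by exact_mod_cast hq0) hqp
    have hmpos : (0 : ℝ) < q.minFac := by exact_mod_cast hmp.pos
    calc Real.log q * (2 * (q : ℝ)⁻¹) ≤ 4 * (q : ℝ) ^ (1 / 4 : ℝ) * (2 * (q : ℝ)⁻¹) := by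
          gcongr
          exact log_le_four_mul_rpow hq0.le
      _ = 8 * (q : ℝ) ^ (-3 / 4 : ℝ) := by
          rw [← Real.rpow_neg_one]
          have : (q : ℝ) ^ (-3 / 4 : ℝ) = (q : ℝ) ^ (1 / 4 : ℝ) * (q : ℝ) ^ (-1 : ℝ) := by
            rw [← Real.rpow_add hq0]; norm_num
          rw [this]
          ring
      _ ≤ 8 * ((q.minFac : ℝ) ^ 2) ^ (-3 / 4 : ℝ) := by
          gcongr 8 * ?_
          exact Real.rpow_le_rpow_of_nonpos (by positivity) hsq (by norm_num)
      _ = _ := by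
          rw [← Real.rpow_natCast, ← Real.rpow_mul hmpos.le]
          norm_num

variable [CharZero O]

variable (O) in
open scoped Classical in
/-- The nonzero prime ideals of norm at most `Y`. -/
noncomputable def primeIdealsLE (Y : ℕ) : Finset (Ideal O) :=
  {P ∈ (Ideal.finite_setOfPred_absNorm_le (S := O) Y).toFinset | Prime P}

variable (O) in
/-- The nonzero prime ideals of norm at most `Y` whose norm is a prime number not dividing `D`. -/
noncomputable def degreeOnePrimesLE (D Y : ℕ) : Finset (Ideal O) :=
  {P ∈ primeIdealsLE O Y | P.absNorm.Prime ∧ ¬ P.absNorm ∣ D}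

lemma mem_primeIdealsLE {Y : ℕ} {P : Ideal O} :
    P ∈ primeIdealsLE O Y ↔ Prime P ∧ P.absNorm ≤ Y := by
  simp [primeIdealsLE, and_comm]

lemma mem_degreeOnePrimesLE {D Y : ℕ} {P : Ideal O} :
    P ∈ degreeOnePrimesLE O D Y ↔
      (Prime P ∧ P.absNorm ≤ Y) ∧ P.absNorm.Prime ∧ ¬ P.absNorm ∣ D := by
  rw [degreeOnePrimesLE, Finset.mem_filter, mem_primeIdealsLE]

lemma sum_degreeOnePrimesLE_le {f : ℕ → ℝ} (hf : ∀ p, 0 ≤ f p) (D Y : ℕ) :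
    ∑ P ∈ degreeOnePrimesLE O D Y, f P.absNorm ≤
      Module.finrank ℤ O * ∑ p ∈ Ioc 0 Y with p.Prime, f p := by
  have h : ∀ P ∈ degreeOnePrimesLE O D Y, P.absNorm.minFac = P.absNorm := fun P hP =>
    (mem_degreeOnePrimesLE.mp hP).2.1.minFac_eq
  calc _ = ∑ P ∈ degreeOnePrimesLE O D Y, f P.absNorm.minFac :=
        Finset.sum_congr rfl fun P hP => by rw [h P hP]
    _ ≤ _ := sum_minFac_absNorm_le (fun P hP => by
        have hP' := mem_degreeOnePrimesLE.mp hP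
        rw [h P hP, Finset.mem_filter, Finset.mem_Ioc]
        exact ⟨hP'.1.1, ⟨hP'.2.1.pos, hP'.1.2⟩, hP'.2.1⟩) fun p _ => hf p

variable (O) in
open scoped Classical in
/-- Prime powers other than first powers of degree one primes not dividing `D` contribute a
bounded amount to `∑ Λ(𝔞) / N(𝔞)`. -/
lemma exists_sum_higher_le {D : ℕ} (hD : D ≠ 0) : ∃ C : ℝ, 0 ≤ C ∧ ∀ Y K : ℕ,
    ∑ P ∈ primeIdealsLE O Y, (∑ k ∈ Icc 1 K,
      if (P.absNorm.Prime ∧ ¬ P.absNorm ∣ D) ∧ k = 1 then 0 else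
        Real.log P.absNorm * ((P.absNorm : ℝ) ^ k)⁻¹) ≤ C := by
  have hsum : Summable fun n : ℕ => 8 * (n : ℝ) ^ (-3 / 2 : ℝ) :=
    (Real.summable_nat_rpow.mpr (by norm_num)).mul_left 8
  have hnn : ∀ n : ℕ, 0 ≤ 8 * (n : ℝ) ^ (-3 / 2 : ℝ) := fun n => by positivity
  refine ⟨Module.finrank ℤ O * (∑' n : ℕ, 8 * (n : ℝ) ^ (-3 / 2 : ℝ)) +
    #(primeIdealsLE O D) * 2, by
      have : 0 ≤ ∑' n : ℕ, 8 * (n : ℝ) ^ (-3 / 2 : ℝ) := tsum_nonneg hnn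
      positivity, fun Y K => ?_⟩
  refine (Finset.sum_le_sum fun P hP =>
    sum_higher_le_rpow_add D K (mem_primeIdealsLE.mp hP).1).trans ?_
  rw [Finset.sum_add_distrib]
  refine add_le_add ?_ ?_
  · calc _ ≤ (Module.finrank ℤ O : ℝ) * ∑ p ∈ Ioc 0 Y, 8 * (p : ℝ) ^ (-3 / 2 : ℝ) := by
          refine sum_minFac_absNorm_le (O := O) (f := fun p : ℕ => 8 * (p : ℝ) ^ (-3 / 2 : ℝ))
            (fun P hP => ?_) fun p _ => hnn p
          have hP := mem_primeIdealsLE.mp hP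
          refine ⟨hP.1, Finset.mem_Ioc.mpr ⟨Nat.minFac_pos _, (Nat.minFac_le ?_).trans hP.2⟩⟩
          linarith [hP.1.two_le_absNorm]
      _ ≤ _ := by
          gcongr
          exact hsum.sum_le_tsum _ fun n _ => hnn n
  · rw [← Finset.sum_filter, Finset.sum_const, nsmul_eq_mul]
    gcongr
    intro P hP
    rw [Finset.mem_filter, mem_primeIdealsLE] at hP
    exact mem_primeIdealsLE.mpr ⟨hP.1.1, Nat.le_of_dvd (Nat.pos_of_ne_zero hD) hP.2.2⟩

end PrimeSums

section Mertens

open NumberField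

variable (F : Type*) [Field F] [NumberField F]

lemma card_chooseBasisIndex_ringOfIntegers :
    Fintype.card (Module.Free.ChooseBasisIndex ℤ (𝓞 F)) = Module.finrank ℚ F := by
  rw [← Module.finrank_eq_card_chooseBasisIndex, RingOfIntegers.rank]

lemma exists_sum_degreeOnePrimesLE_log_mul_rpow_le (D : ℕ) :
    ∃ E : ℝ, 0 ≤ E ∧ ∀ Y : ℕ, ∑ P ∈ degreeOnePrimesLE (𝓞 F) D Y,
      Real.log P.absNorm * (P.absNorm : ℝ) ^ ((Module.finrank ℚ F : ℝ)⁻¹ - 1) ≤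
        E * (Y : ℝ) ^ ((Module.finrank ℚ F : ℝ)⁻¹) := by
  have hd : (1 : ℝ) ≤ Module.finrank ℚ F := by
    exact_mod_cast Nat.one_le_iff_ne_zero.mpr Module.finrank_pos.ne'
  obtain ⟨E, hE, h⟩ := exists_sum_log_mul_rpow_le (δ := (Module.finrank ℚ F : ℝ)⁻¹)
    (by positivity) (inv_le_one_of_one_le₀ hd)
  refine ⟨Module.finrank ℤ (𝓞 F) * E, by positivity, fun Y => ?_⟩
  rw [mul_assoc]
  refine (sum_degreeOnePrimesLE_le (O := 𝓞 F)
    (f := fun p : ℕ => Real.log p * (p : ℝ) ^ ((Module.finrank ℚ F : ℝ)⁻¹ - 1))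
    (fun p => mul_nonneg (Real.log_natCast_nonneg p) (by positivity)) D Y).trans ?_
  gcongr
  exact h Y

/-- The theorem of Mertens for the primes of degree one, upper bound. -/
lemma exists_sum_degreeOnePrimesLE_le (D : ℕ) : ∃ C : ℝ, ∀ X : ℕ, 0 < X →
    ∑ P ∈ degreeOnePrimesLE (𝓞 F) D (X ^ Module.finrank ℚ F),
      Real.log P.absNorm * (P.absNorm : ℝ)⁻¹ ≤ Module.finrank ℚ F * Real.log X + C := by
  classical
  set d := Module.finrank ℚ F with hd
  have hd0 : d ≠ 0 := Module.finrank_pos.ne'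
  set δ : ℝ := (d : ℝ)⁻¹ with hδ
  obtain ⟨M, hM, hnorm⟩ := exists_pow_le_absNorm_le F
  obtain ⟨B, hB, hcount⟩ := exists_card_coordBox_filter_estimate (RingOfIntegers.basis F) 0
  rw [card_chooseBasisIndex_ringOfIntegers, ← hd, ← hδ] at hcount
  obtain ⟨E, hE, hcheb⟩ := exists_sum_degreeOnePrimesLE_log_mul_rpow_le F D
  rw [← hd, ← hδ] at hcheb
  refine ⟨Real.log M + B * E, fun X hX => ?_⟩
  have hX' : (0 : ℝ) < X := by exact_mod_cast hX
  have hMpos : (0 : ℝ) < M := by exact_mod_cast hM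
  obtain ⟨c, hc⟩ := hnorm X
  rw [← hd] at hc
  set box := coordBox (RingOfIntegers.basis F) c X with hbox
  set s := degreeOnePrimesLE (𝓞 F) D (X ^ d) with hs
  have hsP : ∀ P ∈ s, Prime P := fun P hP => (mem_degreeOnePrimesLE.mp hP).1.1
  have hcb : ∀ v ∈ box, X ^ d ≤ (Ideal.span {v}).absNorm ∧
      (Ideal.span {v}).absNorm ≤ M * X ^ d := fun v hv => hc v (mem_coordBox.mp hv)
  have hv0 : ∀ v ∈ box, Ideal.span {v} ≠ ⊥ := fun v hv h => by
    have h1 := (hcb v hv).1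
    rw [h, Ideal.absNorm_bot] at h1
    have : 0 < X ^ d := by positivity
    omega
  have hupper : ∑ v ∈ box, ∑ P ∈ s with P ∣ Ideal.span {v}, Real.log P.absNorm ≤
      (X : ℝ) ^ d * (d * Real.log X + Real.log M) := by
    calc _ ≤ ∑ v ∈ box, (d * Real.log X + Real.log M) := by
          refine Finset.sum_le_sum fun v hv => (sum_log_absNorm_le (hv0 v hv) hsP).trans ?_
          have h1 : ((Ideal.span {v}).absNorm : ℝ) ≤ M * X ^ d := by
            exact_mod_cast (hcb v hv).2
          have h2 : (0 : ℝ) < (Ideal.span {v}).absNorm := by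
            have := (hcb v hv).1
            have h3 : 0 < X ^ d := by positivity
            exact_mod_cast h3.trans_le this
          refine (Real.log_le_log h2 h1).trans_eq ?_
          rw [Real.log_mul hMpos.ne' (by positivity), Real.log_pow]
          ring
      _ = _ := by
          rw [Finset.sum_const, hbox, card_coordBox, card_chooseBasisIndex_ringOfIntegers,
            nsmul_eq_mul]
          push_cast
          rfl
  have hswap : ∑ v ∈ box, ∑ P ∈ s with P ∣ Ideal.span {v}, Real.log P.absNorm =
      ∑ P ∈ s, Real.log P.absNorm * #{v ∈ box | v ∈ P} := by
    simp only [Finset.sum_filter]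
    rw [Finset.sum_comm]
    refine Finset.sum_congr rfl fun P _ => ?_
    simp only [Ideal.dvd_span_singleton]
    rw [← Finset.sum_filter, Finset.sum_const, nsmul_eq_mul, mul_comm]
  have hlower : (X : ℝ) ^ d * (∑ P ∈ s, Real.log P.absNorm * (P.absNorm : ℝ)⁻¹ - B * E) ≤
      ∑ P ∈ s, Real.log P.absNorm * #{v ∈ box | v ∈ P} := by
    have h1 : ∀ P ∈ s, (X : ℝ) ^ d * (Real.log P.absNorm * (P.absNorm : ℝ)⁻¹) -
        (X : ℝ) ^ d * (B / X) * (Real.log P.absNorm * (P.absNorm : ℝ) ^ (δ - 1)) ≤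
        Real.log P.absNorm * #{v ∈ box | v ∈ P} := by
      intro P hP
      have h2 := (hcount P c X (hsP P hP).ne_zero hX).1
      have hpos : (0 : ℝ) < P.absNorm := by
        have := (hsP P hP).two_le_absNorm
        exact_mod_cast (by omega : 0 < P.absNorm)
      rw [Real.rpow_sub_one hpos.ne']
      calc _ = Real.log P.absNorm * ((P.absNorm : ℝ)⁻¹ *
            ((X : ℝ) ^ d * (1 - B * ((P.absNorm : ℝ) ^ δ / X)))) := by field_simp
        _ ≤ Real.log P.absNorm * ((P.absNorm : ℝ)⁻¹ *
            (P.absNorm * #{v ∈ box | v ∈ P})) := by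
            have := Real.log_natCast_nonneg P.absNorm
            gcongr
        _ = _ := by field_simp
    refine le_trans ?_ (Finset.sum_le_sum h1)
    rw [Finset.sum_sub_distrib, ← Finset.mul_sum, ← Finset.mul_sum, mul_sub]
    refine sub_le_sub_left ?_ _
    calc _ ≤ (X : ℝ) ^ d * (B / X) * (E * ((X ^ d : ℕ) : ℝ) ^ δ) := by
          gcongr
          exact hcheb _
      _ = _ := by
          rw [Nat.cast_pow, hδ, Real.pow_rpow_inv_natCast hX'.le hd0]
          field_simp
  have hfin := (hlower.trans_eq hswap.symm).trans hupper
  have := le_of_mul_le_mul_left hfin (by positivity)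
  linarith

/-- The theorem of Mertens for the primes of degree one, lower bound. -/
lemma exists_le_sum_degreeOnePrimesLE {D : ℕ} (hD : D ≠ 0) :
    ∃ (M : ℕ) (C : ℝ), 1 ≤ M ∧ ∀ X : ℕ, 0 < X →
      Module.finrank ℚ F * Real.log X ≤
        ∑ P ∈ degreeOnePrimesLE (𝓞 F) D (M * X ^ Module.finrank ℚ F),
          Real.log P.absNorm * (P.absNorm : ℝ)⁻¹ + C := by
  classical
  set d := Module.finrank ℚ F with hd
  have hd0 : d ≠ 0 := Module.finrank_pos.ne'
  set δ : ℝ := (d : ℝ)⁻¹ with hδ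
  have hδ0 : 0 < δ := by positivity
  obtain ⟨M, hM, hnorm⟩ := exists_pow_le_absNorm_le F
  obtain ⟨B, hB, hcount⟩ := exists_card_coordBox_filter_estimate (RingOfIntegers.basis F) M
  rw [card_chooseBasisIndex_ringOfIntegers, ← hd, ← hδ] at hcount
  obtain ⟨E, hE, hcheb⟩ := exists_sum_degreeOnePrimesLE_log_mul_rpow_le F D
  rw [← hd, ← hδ] at hcheb
  obtain ⟨H, hH, hhigher⟩ := exists_sum_higher_le (𝓞 F) hD
  refine ⟨M, B * (E * (M : ℝ) ^ δ) + (1 + B * (M : ℝ) ^ δ) * H, hM, fun X hX => ?_⟩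
  have hX' : (0 : ℝ) < X := by exact_mod_cast hX
  obtain ⟨c, hc⟩ := hnorm X
  rw [← hd] at hc
  set box := coordBox (RingOfIntegers.basis F) c X with hbox
  set Y := M * X ^ d with hY
  have hYδ : (Y : ℝ) ^ δ = (M : ℝ) ^ δ * X := by
    rw [hY, Nat.cast_mul, Nat.cast_pow, Real.mul_rpow (by positivity) (by positivity), hδ,
      Real.pow_rpow_inv_natCast hX'.le hd0]
  set s := primeIdealsLE (𝓞 F) Y with hs
  have hcb : ∀ v ∈ box, X ^ d ≤ (Ideal.span {v}).absNorm ∧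
      (Ideal.span {v}).absNorm ≤ Y := fun v hv => hc v (mem_coordBox.mp hv)
  have hvpos : ∀ v ∈ box, 0 < (Ideal.span {v}).absNorm := fun v hv =>
    (Nat.pow_pos hX : 0 < X ^ d).trans_le (hcb v hv).1
  have hv0 : ∀ v ∈ box, Ideal.span {v} ≠ ⊥ := fun v hv h => by
    have h1 := hvpos v hv
    simp [h] at h1
  have hlower : (X : ℝ) ^ d * (d * Real.log X) ≤ ∑ v ∈ box, ∑ P ∈ s, ∑ k ∈ Icc 1 Y,
      if P ^ k ∣ Ideal.span {v} then Real.log P.absNorm else 0 := by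
    calc (X : ℝ) ^ d * (d * Real.log X) = ∑ v ∈ box, d * Real.log X := by
          rw [Finset.sum_const, hbox, card_coordBox, card_chooseBasisIndex_ringOfIntegers,
            nsmul_eq_mul]
          push_cast
          rfl
      _ ≤ _ := by
          refine Finset.sum_le_sum fun v hv => ?_
          have h1 : (X : ℝ) ^ d ≤ (Ideal.span {v}).absNorm := by exact_mod_cast (hcb v hv).1
          calc d * Real.log X = Real.log ((X : ℝ) ^ d) := (Real.log_pow _ _).symm
            _ ≤ Real.log (Ideal.span {v}).absNorm := Real.log_le_log (by positivity) h1
            _ ≤ _ := by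
              refine log_absNorm_le_sum (hv0 v hv) (fun P hP hPv => ?_)
                ((hcb v hv).2.trans_lt Nat.lt_two_pow_self)
              exact mem_primeIdealsLE.mpr ⟨hP, (Nat.le_of_dvd (hvpos v hv)
                (map_dvd Ideal.absNorm hPv)).trans (hcb v hv).2⟩
  have hswap : (∑ v ∈ box, ∑ P ∈ s, ∑ k ∈ Icc 1 Y,
      if P ^ k ∣ Ideal.span {v} then Real.log P.absNorm else 0) =
      ∑ P ∈ s, ∑ k ∈ Icc 1 Y, Real.log P.absNorm * #{v ∈ box | v ∈ P ^ k} := by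
    rw [Finset.sum_comm]
    refine Finset.sum_congr rfl fun P _ => ?_
    rw [Finset.sum_comm]
    refine Finset.sum_congr rfl fun k _ => ?_
    simp only [Ideal.dvd_span_singleton]
    rw [← Finset.sum_filter, Finset.sum_const, nsmul_eq_mul, mul_comm]
  have hterm : ∀ P ∈ s, ∀ k ∈ Icc 1 Y, Real.log P.absNorm * #{v ∈ box | v ∈ P ^ k} ≤
      (X : ℝ) ^ d * ((if (P.absNorm.Prime ∧ ¬ P.absNorm ∣ D) ∧ k = 1 then
          Real.log P.absNorm * (P.absNorm : ℝ)⁻¹ +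
            B / X * (Real.log P.absNorm * (P.absNorm : ℝ) ^ (δ - 1)) else 0) +
        (1 + B * (M : ℝ) ^ δ) * (if (P.absNorm.Prime ∧ ¬ P.absNorm ∣ D) ∧ k = 1 then 0 else
          Real.log P.absNorm * ((P.absNorm : ℝ) ^ k)⁻¹)) := by
    intro P hP k hk
    have hP' := mem_primeIdealsLE.mp hP
    have hpos : (0 : ℝ) < P.absNorm := by
      have := hP'.1.two_le_absNorm
      exact_mod_cast (by omega : 0 < P.absNorm)
    have hlog := Real.log_natCast_nonneg P.absNorm
    have hest := (hcount (P ^ k) c X (pow_ne_zero k hP'.1.ne_zero) hX).2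
    by_cases hgood : (P.absNorm.Prime ∧ ¬ P.absNorm ∣ D) ∧ k = 1
    · obtain ⟨-, rfl⟩ := id hgood
      rw [if_pos hgood, if_pos hgood, mul_zero, add_zero]
      rw [pow_one] at hest ⊢
      calc Real.log P.absNorm * #{v ∈ box | v ∈ P} = Real.log P.absNorm * ((P.absNorm : ℝ)⁻¹ *
            (P.absNorm * #{v ∈ box | v ∈ P})) := by field_simp
        _ ≤ Real.log P.absNorm * ((P.absNorm : ℝ)⁻¹ *
            ((X : ℝ) ^ d * (1 + B * ((P.absNorm : ℝ) ^ δ / X)))) := by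
            exact mul_le_mul_of_nonneg_left
              (mul_le_mul_of_nonneg_left (hest hP'.2) (by positivity)) hlog
        _ = _ := by
            rw [Real.rpow_sub_one hpos.ne']
            field_simp
    · rw [if_neg hgood, if_neg hgood, zero_add]
      by_cases hk : P.absNorm ^ k ≤ Y
      · rw [map_pow] at hest
        have h1 := hest hk
        rw [Nat.cast_pow] at h1
        have h2 : ((P.absNorm : ℝ) ^ k) ^ δ ≤ (M : ℝ) ^ δ * X := by
          rw [← hYδ]
          exact Real.rpow_le_rpow (by positivity) (by exact_mod_cast hk) hδ0.le
        have h3 : ((P.absNorm : ℝ) ^ k) ^ δ / X ≤ (M : ℝ) ^ δ := by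
          rwa [div_le_iff₀ hX']
        calc Real.log P.absNorm * #{v ∈ box | v ∈ P ^ k} =
              Real.log P.absNorm * (((P.absNorm : ℝ) ^ k)⁻¹ *
                ((P.absNorm : ℝ) ^ k * #{v ∈ box | v ∈ P ^ k})) := by field_simp
          _ ≤ Real.log P.absNorm * (((P.absNorm : ℝ) ^ k)⁻¹ *
                ((X : ℝ) ^ d * (1 + B * (M : ℝ) ^ δ))) := by
              refine mul_le_mul_of_nonneg_left
                (mul_le_mul_of_nonneg_left (h1.trans ?_) (by positivity)) hlog
              gcongr
          _ = _ := by ring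
      · have hempty : {v ∈ box | v ∈ P ^ k} = ∅ := by
          refine Finset.filter_eq_empty_iff.mpr fun v hv hvP => hk ?_
          rw [← map_pow]
          exact (Nat.le_of_dvd (hvpos v hv) (map_dvd Ideal.absNorm
            (Ideal.dvd_span_singleton.mpr hvP))).trans (hcb v hv).2
        rw [hempty, Finset.card_empty, Nat.cast_zero, mul_zero]
        positivity
  have hgoodsum : (∑ P ∈ s, ∑ k ∈ Icc 1 Y, if (P.absNorm.Prime ∧ ¬ P.absNorm ∣ D) ∧ k = 1 then
          Real.log P.absNorm * (P.absNorm : ℝ)⁻¹ +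
            B / X * (Real.log P.absNorm * (P.absNorm : ℝ) ^ (δ - 1)) else 0) =
      ∑ P ∈ degreeOnePrimesLE (𝓞 F) D Y, (Real.log P.absNorm * (P.absNorm : ℝ)⁻¹ +
            B / X * (Real.log P.absNorm * (P.absNorm : ℝ) ^ (δ - 1))) := by
    rw [degreeOnePrimesLE, Finset.sum_filter]
    refine Finset.sum_congr rfl fun P hP => ?_
    have hYpos : 1 ≤ Y := Nat.mul_pos hM (Nat.pow_pos hX)
    by_cases hgood : P.absNorm.Prime ∧ ¬ P.absNorm ∣ D
    · simp [hgood, hYpos]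
    · simp [hgood]
  have hupper : ∑ P ∈ s, ∑ k ∈ Icc 1 Y, Real.log P.absNorm * #{v ∈ box | v ∈ P ^ k} ≤
      (X : ℝ) ^ d * (∑ P ∈ degreeOnePrimesLE (𝓞 F) D Y,
        Real.log P.absNorm * (P.absNorm : ℝ)⁻¹ +
          (B * (E * (M : ℝ) ^ δ) + (1 + B * (M : ℝ) ^ δ) * H)) := by
    refine (Finset.sum_le_sum fun P hP => Finset.sum_le_sum (hterm P hP)).trans ?_
    simp only [← Finset.mul_sum, Finset.sum_add_distrib]
    rw [hgoodsum, Finset.sum_add_distrib, ← Finset.mul_sum, add_assoc]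
    refine mul_le_mul_of_nonneg_left (add_le_add_right (add_le_add ?_ ?_) _) (by positivity)
    · calc _ ≤ B / X * (E * (Y : ℝ) ^ δ) :=
            mul_le_mul_of_nonneg_left (hcheb Y) (by positivity)
        _ = _ := by rw [hYδ]; field_simp
    · exact mul_le_mul_of_nonneg_left (hhigher Y Y) (by positivity)
  exact le_of_mul_le_mul_left ((hlower.trans_eq hswap).trans hupper) (by positivity)

end Mertens

section Splitting

open NumberField

lemma RingHom.eq_of_ker_eq_zmod {R : Type*} [CommRing R] {p : ℕ} [NeZero p] {φ ψ : R →+* ZMod p}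
    (h : RingHom.ker φ = RingHom.ker ψ) : φ = ψ := by
  ext x
  have h1 : x - ((φ x).val : R) ∈ RingHom.ker φ := by simp [RingHom.mem_ker]
  rw [h, RingHom.mem_ker, map_sub, map_natCast, ZMod.natCast_zmod_val, sub_eq_zero] at h1
  exact h1.symm

lemma absNorm_ker_zmod {R : Type*} [CommRing R] [IsDedekindDomain R] [Module.Free ℤ R] {p : ℕ}
    (φ : R →+* ZMod p) : (RingHom.ker φ).absNorm = p := by
  rw [← Ideal.natCard_quotient_eq_absNorm,
    Nat.card_congr (RingHom.quotientKerEquivOfSurjective (ZMod.ringHom_surjective φ)).toEquiv,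
    Nat.card_zmod]

lemma card_ringHom_zmod_le {O : Type*} [CommRing O] [IsDedekindDomain O] [Module.Free ℤ O]
    [Module.Finite ℤ O] [CharZero O] {p : ℕ} (hp : p.Prime) :
    Finite (O →+* ZMod p) ∧ Nat.card (O →+* ZMod p) ≤ Module.finrank ℤ O := by
  have : Fact p.Prime := ⟨hp⟩
  set s : Finset (Ideal O) := {P ∈ primeIdealsLE O p | P.absNorm = p} with hs
  have hmem : ∀ φ : O →+* ZMod p, RingHom.ker φ ∈ s := fun φ => by
    have h1 := absNorm_ker_zmod φ
    refine Finset.mem_filter.mpr ⟨mem_primeIdealsLE.mpr ⟨?_, h1.le⟩, h1⟩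
    refine Ideal.prime_of_isPrime (fun h => ?_) (RingHom.ker_isPrime φ)
    rw [h, Ideal.absNorm_bot] at h1
    exact hp.ne_zero h1.symm
  have hinj : Function.Injective fun φ : O →+* ZMod p => (⟨RingHom.ker φ, hmem φ⟩ : s) :=
    fun φ ψ h => RingHom.eq_of_ker_eq_zmod (congrArg Subtype.val h)
  refine ⟨Finite.of_injective _ hinj, (Nat.card_le_card_of_injective _ hinj).trans ?_⟩
  rw [Nat.card_eq_fintype_card, Fintype.card_coe]
  refine card_le_finrank_of_natCast_mem hp.one_lt fun P hP => ?_
  rw [hs, Finset.mem_filter, mem_primeIdealsLE] at hP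
  exact ⟨hP.1.1, by rw [hP.2, hp.minFac_eq]⟩

variable (F : Type*) [Field F] [NumberField F] [IsGalois ℚ F]

/-- In a Galois number field, all but finitely many primes that have a prime ideal of degree one
above them split completely. -/
lemma exists_splitsCompletely_absNorm : ∃ D : ℕ, D ≠ 0 ∧ ∀ P : Ideal (𝓞 F), P.IsPrime →
    P.absNorm.Prime → ¬ P.absNorm ∣ D → SplitsCompletely F P.absNorm := by
  classical
  let act : (F ≃ₐ[ℚ] F) → 𝓞 F →+* 𝓞 F := fun σ =>
    RingOfIntegers.mapRingHom (σ : F →+* F)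
  have hact : Function.Injective act := fun σ τ h => by
    have hO : ∀ x : 𝓞 F, σ x = τ x := fun x =>
      congrArg (fun f : 𝓞 F →+* 𝓞 F => ((f x : 𝓞 F) : F)) h
    ext x
    obtain ⟨a, b, hb, rfl⟩ := IsFractionRing.div_surjective (A := 𝓞 F) x
    rw [map_div₀, map_div₀]
    exact congrArg₂ _ (hO a) (hO b)
  have hne : ∀ σ τ : F ≃ₐ[ℚ] F, ∃ x : 𝓞 F, σ ≠ τ → act σ x ≠ act τ x := fun σ τ => by
    by_cases h : σ = τ
    · exact ⟨0, fun h' => (h' h).elim⟩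
    · obtain ⟨x, hx⟩ := DFunLike.ne_iff.mp (hact.ne h)
      exact ⟨x, fun _ => hx⟩
  choose x hx using hne
  let y : (F ≃ₐ[ℚ] F) × (F ≃ₐ[ℚ] F) → 𝓞 F := fun z => act z.1 (x z.1 z.2) - act z.2 (x z.1 z.2)
  have hy : ∀ σ τ, σ ≠ τ → y (σ, τ) ≠ 0 := fun σ τ h => sub_ne_zero.mpr (hx σ τ h)
  refine ⟨∏ z : (F ≃ₐ[ℚ] F) × (F ≃ₐ[ℚ] F) with z.1 ≠ z.2, (Ideal.span {y z}).absNorm,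
    Finset.prod_ne_zero_iff.mpr fun z hz => ?_, fun P hP hp hD => ?_⟩
  · rw [Ne, Ideal.absNorm_eq_zero_iff, Ideal.span_singleton_eq_bot]
    exact hy z.1 z.2 (Finset.mem_filter.mp hz).2
  set p := P.absNorm with hpdef
  have : Fact p.Prime := ⟨hp⟩
  have hcard : Nat.card (𝓞 F ⧸ P) = p := Ideal.natCard_quotient_eq_absNorm P
  have : Finite (𝓞 F ⧸ P) := Nat.finite_of_card_ne_zero (hcard ▸ hp.ne_zero)
  have : Fintype (𝓞 F ⧸ P) := Fintype.ofFinite _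
  let e : ZMod p ≃+* 𝓞 F ⧸ P :=
    ZMod.ringEquivOfPrime _ hp (by rw [← Nat.card_eq_fintype_card, hcard])
  let φ : 𝓞 F →+* ZMod p := (e.symm : 𝓞 F ⧸ P →+* ZMod p).comp (Ideal.Quotient.mk P)
  have hinj : Function.Injective fun σ : F ≃ₐ[ℚ] F => φ.comp (act σ) := by
    intro σ τ h
    by_contra hστ
    have h0 : φ (y (σ, τ)) = 0 := by
      have h1 := congrArg (fun f : 𝓞 F →+* ZMod p => f (x σ τ)) h
      simp only [RingHom.comp_apply] at h1
      rw [map_sub, sub_eq_zero]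
      exact h1
    refine hD (dvd_trans ?_ (Finset.dvd_prod_of_mem _
      (Finset.mem_filter.mpr ⟨Finset.mem_univ (σ, τ), hστ⟩)))
    obtain ⟨γ, hγ⟩ := Ideal.mem_span_singleton'.mp (Ideal.absNorm_mem (Ideal.span {y (σ, τ)}))
    have h2 := congrArg φ hγ
    rw [map_mul, h0, mul_zero, map_natCast] at h2
    exact (ZMod.natCast_eq_zero_iff _ _).mp h2.symm
  obtain ⟨hfin, hle⟩ := card_ringHom_zmod_le (O := 𝓞 F) hp
  rw [RingOfIntegers.rank] at hle
  have hge := Nat.card_le_card_of_injective _ hinj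
  rw [IsGalois.card_aut_eq_finrank] at hge
  exact le_antisymm hle hge

open scoped Classical in
/-- The completely split primes between `n` and a suitable multiple of `n` have a product larger
than `exp (κ n)`. -/
lemma exists_lt_sum_log_splitsCompletely {κ : ℝ} (hκ : 0 ≤ κ) : ∃ C : ℝ, 1 ≤ C ∧ ∀ n : ℝ, 1 ≤ n →
    κ * n < ∑ p ∈ ({p ∈ range (⌊C * n⌋₊ + 1) |
      p.Prime ∧ n ≤ p ∧ SplitsCompletely F p} : Finset ℕ), Real.log p := by
  obtain ⟨D, hD, hsplit⟩ := exists_splitsCompletely_absNorm F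
  obtain ⟨c₁, hc₁⟩ := exists_sum_degreeOnePrimesLE_le F D
  obtain ⟨M, c₂, hM, hc₂⟩ := exists_le_sum_degreeOnePrimesLE F hD
  set d := Module.finrank ℚ F with hd
  have hd0 : d ≠ 0 := Module.finrank_pos.ne'
  have hd' : (0 : ℝ) < d := by positivity
  obtain ⟨W, hW⟩ := exists_nat_gt (Real.exp (κ + (c₁ + c₂) / d))
  have hW' : (0 : ℝ) < W := (Real.exp_pos _).trans hW
  have hW0 : 0 < W := by exact_mod_cast hW'
  have hlogW : κ + (c₁ + c₂) / d < Real.log W := (Real.lt_log_iff_exp_lt hW').mpr hW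
  have hMW : 1 ≤ M * (2 * W) ^ d := Nat.mul_pos hM (by positivity)
  refine ⟨(M * (2 * W) ^ d : ℕ), by exact_mod_cast hMW, fun n hn => ?_⟩
  set S : Finset ℕ := {p ∈ range (⌊((M * (2 * W) ^ d : ℕ) : ℝ) * n⌋₊ + 1) |
    p.Prime ∧ n ≤ p ∧ SplitsCompletely F p} with hS
  have hn0 : 0 ≤ n := by linarith
  have hroot : 1 ≤ n ^ (d : ℝ)⁻¹ := Real.one_le_rpow hn (by positivity)
  set X := ⌈n ^ (d : ℝ)⁻¹⌉₊ with hX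
  have hX0 : 0 < X := Nat.ceil_pos.mpr (by linarith)
  have hX' : (0 : ℝ) < X := by exact_mod_cast hX0
  have hnX : n ≤ (X : ℝ) ^ d := by
    calc n = (n ^ (d : ℝ)⁻¹) ^ d := (Real.rpow_inv_natCast_pow hn0 hd0).symm
      _ ≤ _ := by gcongr; exact Nat.le_ceil _
  have hXn : (X : ℝ) ^ d ≤ 2 ^ d * n := by
    calc (X : ℝ) ^ d ≤ (2 * n ^ (d : ℝ)⁻¹) ^ d := by
          gcongr
          have := Nat.ceil_lt_add_one (by linarith : 0 ≤ n ^ (d : ℝ)⁻¹)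
          linarith
      _ = _ := by rw [mul_pow, Real.rpow_inv_natCast_pow hn0 hd0]
  set Y := M * (X * W) ^ d with hY
  have hYn : (Y : ℝ) ≤ ((M * (2 * W) ^ d : ℕ) : ℝ) * n := by
    rw [hY]
    push_cast
    rw [mul_pow, mul_pow]
    calc (M : ℝ) * ((X : ℝ) ^ d * (W : ℝ) ^ d) ≤ M * (2 ^ d * n * (W : ℝ) ^ d) := by gcongr
      _ = _ := by ring
  have hXY : X ^ d ≤ Y := by
    calc X ^ d = 1 * (X * 1) ^ d := by simp
      _ ≤ _ := by rw [hY]; gcongr; exact hW0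
  have hsub : {P ∈ degreeOnePrimesLE (𝓞 F) D Y | P.absNorm ≤ X ^ d} =
      degreeOnePrimesLE (𝓞 F) D (X ^ d) := by
    ext P
    simp only [Finset.mem_filter, mem_degreeOnePrimesLE]
    constructor
    · rintro ⟨⟨⟨h1, -⟩, h2⟩, h3⟩
      exact ⟨⟨h1, h3⟩, h2⟩
    · rintro ⟨⟨h1, h3⟩, h2⟩
      exact ⟨⟨⟨h1, h3.trans hXY⟩, h2⟩, h3⟩
  set T : Finset (Ideal (𝓞 F)) := {P ∈ degreeOnePrimesLE (𝓞 F) D Y | ¬ P.absNorm ≤ X ^ d} with hT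
  have hmemT : ∀ P ∈ T, (Prime P ∧ P.absNorm ≤ Y) ∧ (P.absNorm.Prime ∧ ¬ P.absNorm ∣ D) ∧
      X ^ d < P.absNorm := fun P hP => by
    rw [hT, Finset.mem_filter, mem_degreeOnePrimesLE, not_le] at hP
    exact ⟨hP.1.1, hP.1.2, hP.2⟩
  have hlow : d * Real.log W - (c₁ + c₂) ≤
      ∑ P ∈ T, Real.log P.absNorm * (P.absNorm : ℝ)⁻¹ := by
    have h1 := hc₁ X hX0
    have h2 := hc₂ (X * W) (Nat.mul_pos hX0 hW0)
    rw [← Finset.sum_filter_add_sum_filter_not _ (fun P => P.absNorm ≤ X ^ d), hsub, ← hT,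
      Nat.cast_mul, Real.log_mul hX'.ne' hW'.ne'] at h2
    linarith
  have hupp : ∑ P ∈ T, Real.log P.absNorm * (P.absNorm : ℝ)⁻¹ ≤
      (d * ∑ p ∈ S, Real.log p) * ((X : ℝ) ^ d)⁻¹ := by
    calc _ ≤ ∑ P ∈ T, Real.log P.absNorm.minFac * ((X : ℝ) ^ d)⁻¹ := by
          refine Finset.sum_le_sum fun P hP => ?_
          have hP' := hmemT P hP
          rw [hP'.2.1.1.minFac_eq]
          have h1 : (X : ℝ) ^ d ≤ P.absNorm := by exact_mod_cast hP'.2.2.le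
          have := Real.log_natCast_nonneg P.absNorm
          gcongr
      _ = (∑ P ∈ T, Real.log P.absNorm.minFac) * ((X : ℝ) ^ d)⁻¹ := by rw [Finset.sum_mul]
      _ ≤ _ := by
          refine mul_le_mul_of_nonneg_right ?_ (by positivity)
          rw [hd, ← RingOfIntegers.rank F]
          refine sum_minFac_absNorm_le (f := fun p : ℕ => Real.log p) (fun P hP => ?_)
            fun p _ => Real.log_natCast_nonneg p
          obtain ⟨⟨hP1, hPY⟩, ⟨hPp, hPD⟩, hPX⟩ := hmemT P hP
          refine ⟨hP1, ?_⟩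
          rw [hPp.minFac_eq, hS, Finset.mem_filter, Finset.mem_range, Nat.lt_succ_iff]
          refine ⟨Nat.le_floor ?_, hPp, ?_, hsplit P (Ideal.isPrime_of_prime hP1) hPp hPD⟩
          · exact le_trans (by exact_mod_cast hPY) hYn
          · exact hnX.trans (by exact_mod_cast hPX.le)
  have hXd : (0 : ℝ) < (X : ℝ) ^ d := by positivity
  have hfin : κ < (∑ p ∈ S, Real.log p) * ((X : ℝ) ^ d)⁻¹ := by
    have h1 : d * κ < d * Real.log W - (c₁ + c₂) := by
      have h2 := mul_lt_mul_of_pos_left hlogW hd'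
      rw [mul_add, mul_div_cancel₀ _ hd'.ne'] at h2
      linarith
    have h2 := h1.trans_le (hlow.trans hupp)
    rw [mul_assoc] at h2
    exact lt_of_mul_lt_mul_left h2 hd'.le
  rw [← div_eq_mul_inv, lt_div_iff₀ hXd] at hfin
  exact lt_of_le_of_lt (by gcongr) hfin

end Splitting

section ZInvN

lemma exists_natCast_pow_mul_eq_intCast {N : ℕ} (hN : N ≠ 0) {r : ℚ} (hr : r ∈ ZInvN N) :
    ∃ k : ℕ, ∃ a : ℤ, (N : ℚ) ^ k * r = a := by
  have hN' : (N : ℚ) ≠ 0 := by exact_mod_cast hN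
  unfold ZInvN at hr
  induction hr using Subring.closure_induction with
  | mem x hx =>
    rw [Set.mem_singleton_iff] at hx
    exact ⟨1, 1, by rw [hx]; simp [hN']⟩
  | zero => exact ⟨0, 0, by simp⟩
  | one => exact ⟨0, 1, by simp⟩
  | add x y _ _ hx hy =>
    obtain ⟨k, a, ha⟩ := hx
    obtain ⟨l, b, hb⟩ := hy
    refine ⟨k + l, N ^ l * a + N ^ k * b, ?_⟩
    push_cast
    rw [← ha, ← hb]
    ring
  | neg x _ hx =>
    obtain ⟨k, a, ha⟩ := hx
    exact ⟨k, -a, by push_cast; rw [← ha]; ring⟩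
  | mul x y _ _ hx hy =>
    obtain ⟨k, a, ha⟩ := hx
    obtain ⟨l, b, hb⟩ := hy
    exact ⟨k + l, a * b, by push_cast; rw [← ha, ← hb]; ring⟩

/-- The numerator of `r` is bounded exponentially in the height of `r`. -/
lemma exists_intCast_eq_log_abs_le {N : ℕ} (hN : 2 ≤ N) {r : ℚ} (hr : r ∈ ZInvN N) (hr0 : r ≠ 0) :
    ∃ a : ℤ, a ≠ 0 ∧ (N : ℚ) ^ denomExp N r * r = a ∧
      Real.log |(a : ℝ)| ≤ 2 * Real.log N * htZ N r := by
  have hN' : (N : ℚ) ≠ 0 := by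
    have : N ≠ 0 := by omega
    exact_mod_cast this
  have hNR : (1 : ℝ) < N := by exact_mod_cast (by omega : 1 < N)
  have hlogN : 0 < Real.log N := Real.log_pos hNR
  obtain ⟨a, ha⟩ : denomExp N r ∈ {k : ℕ | ∃ a : ℤ, (N : ℚ) ^ k * r = (a : ℚ)} :=
    Nat.sInf_mem (exists_natCast_pow_mul_eq_intCast (by omega) hr)
  have ha0 : a ≠ 0 := by
    rintro rfl
    simp [hN', hr0] at ha
  refine ⟨a, ha0, ha, ?_⟩
  have haR : (a : ℝ) = (N : ℝ) ^ denomExp N r * r := by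
    have := congrArg (fun q : ℚ => (q : ℝ)) ha
    push_cast at this
    exact this.symm
  have hrR : (r : ℝ) ≠ 0 := by exact_mod_cast hr0
  have h1 : (denomExp N r : ℝ) ≤ htZ N r := by
    rw [htZ, if_neg hr0]; exact le_max_left _ _
  have h2 : Real.logb N |(r : ℝ)| ≤ htZ N r := by
    rw [htZ, if_neg hr0]; exact (le_max_right _ _).trans (le_max_right _ _)
  have h3 : Real.log |(r : ℝ)| ≤ htZ N r * Real.log N := by
    rwa [Real.logb, div_le_iff₀ hlogN] at h2
  rw [Real.log_abs, haR, Real.log_mul (by positivity) hrR, Real.log_pow, ← Real.log_abs (r : ℝ)]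
  have h4 := mul_le_mul_of_nonneg_right h1 hlogN.le
  linarith

end ZInvN

theorem stmt12 (N : ℕ) (hN : 2 ≤ N)
    (F : Type*) [Field F] [NumberField F] [IsGalois ℚ F] :
    ∃ C : ℝ, 1 ≤ C ∧
      ∀ (r : ℚ) (hr : r ∈ ZInvN N), r ≠ 0 →
        ∀ n : ℝ, max (N : ℝ) (htZ N r) ≤ n →
          ∃ p : ℕ, p.Prime ∧ (n ≤ p) ∧ ((p : ℝ) ≤ C * n) ∧ SplitsCompletely F p ∧
            ∀ f : ↥(ZInvN N) →+* ZMod p, f ⟨r, hr⟩ ≠ 0 := by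
  classical
  have hlogN : 0 ≤ Real.log N := Real.log_natCast_nonneg N
  obtain ⟨C, hC, h⟩ := exists_lt_sum_log_splitsCompletely F (κ := 2 * Real.log N) (by positivity)
  refine ⟨C, hC, fun r hr hr0 n hn => ?_⟩
  have hNn : (N : ℝ) ≤ n := (le_max_left _ _).trans hn
  have hN1 : (1 : ℝ) ≤ N := by exact_mod_cast (by omega : 1 ≤ N)
  obtain ⟨a, ha0, ha, hlog⟩ := exists_intCast_eq_log_abs_le hN hr hr0
  have hsum := h n (hN1.trans hNn)
  set S : Finset ℕ := {p ∈ range (⌊C * n⌋₊ + 1) | p.Prime ∧ n ≤ p ∧ SplitsCompletely F p} with hS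
  obtain ⟨p, hpS, hpa⟩ : ∃ p ∈ S, ¬ (p : ℤ) ∣ a := by
    by_contra! hdvd
    have hprod : ∏ p ∈ S, p ∣ a.natAbs :=
      Finset.prod_primes_dvd _ (fun p hp => (Finset.mem_filter.mp hp).2.1.prime)
        fun p hp => Int.natCast_dvd.mp (hdvd p hp)
    have hpos : ∀ p ∈ S, (0 : ℝ) < p := fun p hp =>
      Nat.cast_pos.mpr (Finset.mem_filter.mp hp).2.1.pos
    have hle : ((∏ p ∈ S, p : ℕ) : ℝ) ≤ |(a : ℝ)| := by
      have h1 := Nat.le_of_dvd (Int.natAbs_pos.mpr ha0) hprod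
      rw [← Int.cast_abs, ← Int.natCast_natAbs, Int.cast_natCast]
      exact_mod_cast h1
    have hlogprod : ∑ p ∈ S, Real.log p ≤ Real.log |(a : ℝ)| := by
      rw [← Real.log_prod fun p hp => (hpos p hp).ne']
      refine Real.log_le_log (Finset.prod_pos hpos) ?_
      rwa [← Nat.cast_prod]
    have hht : 2 * Real.log N * htZ N r ≤ 2 * Real.log N * n := by
      gcongr
      exact (le_max_right _ _).trans hn
    linarith
  obtain ⟨hpC, hp, hnp, hsplit⟩ := Finset.mem_filter.mp hpS
  have hn0 : 0 ≤ C * n := by nlinarith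
  refine ⟨p, hp, hnp, (Nat.le_floor_iff hn0).mp (Nat.lt_succ_iff.mp (Finset.mem_range.mp hpC)),
    hsplit, fun f hf => hpa ?_⟩
  have hmul : (N : ZInvN N) ^ denomExp N r * ⟨r, hr⟩ = (a : ZInvN N) :=
    Subtype.ext (by push_cast; exact ha)
  have h1 := congrArg f hmul
  rw [map_mul, hf, mul_zero, map_intCast] at h1
  exact (ZMod.intCast_zmod_eq_zero_iff_dvd a p).mp h1.symm
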